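/- There exists ε₁ > 0 depending only on N and M such that: if 0 < ε < ε₁, 0 < s ≤ 1, u ∈ P₁(0,M), e is a unit vector, and sup_{x ∈ B(0,s)} |u(x) − (max(⟨x,e⟩,0))²/2| < ε·s², then s·D_e u(x) − u(x) ≥ 0 for all x ∈ B(0,s/2) (where D_e u is the directional derivative of u in direction e), and u ≥ 0 on B(0,s/4). -/

import Mathlib

open MeasureTheory Metric Set Filter
open scoped RealInnerProductSpace

noncomputable section

/-- The Laplacian of `φ` at `x`, as the sum of the pure second derivatives. -/
def lap (N : ℕ) (φ : EuclideanSpace ℝ (Fin N) → ℝ) (x : EuclideanSpace ℝ (Fin N)) : ℝ :=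
  ∑ i : Fin N,
    fderiv ℝ (fun y => fderiv ℝ φ y (EuclideanSpace.single i 1)) x (EuclideanSpace.single i 1)

/-- Membership in the class `P_r(z, M)`. -/
def MemP (N : ℕ) (r : ℝ) (z : EuclideanSpace ℝ (Fin N)) (M : ℝ)
    (Ω : Set (EuclideanSpace ℝ (Fin N))) (u : EuclideanSpace ℝ (Fin N) → ℝ) : Prop :=
  IsOpen Ω ∧ ContDiff ℝ 1 u ∧
    (∀ φ : EuclideanSpace ℝ (Fin N) → ℝ, ContDiff ℝ (⊤ : ℕ∞) φ → tsupport φ ⊆ ball z r →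
      ∫ x, u x * lap N φ x = ∫ x in Ω, φ x) ∧
    (∀ x ∈ ball z r \ Ω, u x = 0 ∧ gradient u x = 0) ∧
    (∀ x ∈ ball z r, |u x| ≤ M) ∧
    z ∈ frontier Ω

/-- Membership in the class `P_∞(0, M)` of global solutions with quadratic growth. -/
def MemPinf (N : ℕ) (M : ℝ) (Ω : Set (EuclideanSpace ℝ (Fin N)))
    (u : EuclideanSpace ℝ (Fin N) → ℝ) : Prop :=
  IsOpen Ω ∧ ContDiff ℝ 1 u ∧
    (∀ φ : EuclideanSpace ℝ (Fin N) → ℝ, ContDiff ℝ (⊤ : ℕ∞) φ → HasCompactSupport φ →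
      ∫ x, u x * lap N φ x = ∫ x in Ω, φ x) ∧
    (∀ x ∈ Ωᶜ, u x = 0 ∧ gradient u x = 0) ∧
    (0 : EuclideanSpace ℝ (Fin N)) ∈ frontier Ω ∧
    (∀ x, |u x| ≤ M * (‖x‖ ^ 2 + 1))

/-- The minimum diameter of a set: the smallest width of a slab containing it. -/
def MD (N : ℕ) (D : Set (EuclideanSpace ℝ (Fin N))) : ℝ :=
  ⨅ e : {e : EuclideanSpace ℝ (Fin N) // ‖e‖ = 1},
    ((⨆ x : D, ⟪(x : EuclideanSpace ℝ (Fin N)), (e : EuclideanSpace ℝ (Fin N))⟫) -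
      ⨅ x : D, ⟪(x : EuclideanSpace ℝ (Fin N)), (e : EuclideanSpace ℝ (Fin N))⟫)

/-- The density function `δ_r(u)`. -/
def deltaFn (N : ℕ) (u : EuclideanSpace ℝ (Fin N) → ℝ) (r : ℝ) : ℝ :=
  MD N ({x | u x = 0 ∧ gradient u x = 0} ∩ ball 0 r) / r

/-- Half-space solutions `x ↦ (max(⟪x,e⟫,0))²/2`. -/
def IsHalfSpaceSol (N : ℕ) (u : EuclideanSpace ℝ (Fin N) → ℝ) : Prop :=
  ∃ e : EuclideanSpace ℝ (Fin N), ‖e‖ = 1 ∧ ∀ x, u x = (max ⟪x, e⟫ 0) ^ 2 / 2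

/-- `∂Ω ∩ B` is the graph of a `C¹` function. -/
def IsC1Graph (N : ℕ) (Ω B : Set (EuclideanSpace ℝ (Fin N))) : Prop :=
  ∃ (e : EuclideanSpace ℝ (Fin N)) (f : EuclideanSpace ℝ (Fin N) → ℝ),
    ‖e‖ = 1 ∧ ContDiff ℝ 1 f ∧
    Ω ∩ B = {x ∈ B | f (x - ⟪x, e⟫ • e) < ⟪x, e⟫} ∧
    frontier Ω ∩ B = {x ∈ B | ⟪x, e⟫ = f (x - ⟪x, e⟫ • e)}

/-- `∂Ω ∩ B` is the graph of a real-analytic function. -/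
def IsAnalyticGraph (N : ℕ) (Ω B : Set (EuclideanSpace ℝ (Fin N))) : Prop :=
  ∃ (e : EuclideanSpace ℝ (Fin N)) (f : EuclideanSpace ℝ (Fin N) → ℝ),
    ‖e‖ = 1 ∧ (∀ x, AnalyticAt ℝ f x) ∧
    Ω ∩ B = {x ∈ B | f (x - ⟪x, e⟫ • e) < ⟪x, e⟫} ∧
    frontier Ω ∩ B = {x ∈ B | ⟪x, e⟫ = f (x - ⟪x, e⟫ • e)}

/-- The Alt–Caffarelli–Friedman functional `φ(r, v)` centered at the origin. -/
def acf (N : ℕ) (v : EuclideanSpace ℝ (Fin N) → ℝ) (r : ℝ) : ℝ :=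
  r ^ (-4 : ℤ) *
    (∫ x in ball (0 : EuclideanSpace ℝ (Fin N)) r,
      ‖gradient (fun y => max (v y) 0) x‖ ^ 2 * ‖x‖ ^ ((2 : ℤ) - (N : ℤ))) *
    ∫ x in ball (0 : EuclideanSpace ℝ (Fin N)) r,
      ‖gradient (fun y => max (-v y) 0) x‖ ^ 2 * ‖x‖ ^ ((2 : ℤ) - (N : ℤ))

/-- `S_j(z, u) = sup_{B(z, 2^{-j})} |u|`. -/
def Sj (N : ℕ) (z : EuclideanSpace ℝ (Fin N)) (u : EuclideanSpace ℝ (Fin N) → ℝ) (j : ℕ) : ℝ :=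
  sSup ((fun x => |u x|) '' ball z ((2 : ℝ) ^ (-(j : ℤ))))

open InnerProductSpace in
theorem lap_eq_laplacian {N : ℕ} {g : EuclideanSpace ℝ (Fin N) → ℝ} (hg : ContDiff ℝ 2 g) :
    lap N g = Laplacian.laplacian g := by
  ext x
  rw [laplacian_eq_iteratedFDeriv_orthonormalBasis g (EuclideanSpace.basisFun (Fin N) ℝ)]
  refine Finset.sum_congr rfl fun i _ => ?_
  have hd : DifferentiableAt ℝ (fderiv ℝ g) x :=
    ((hg.fderiv_right (m := 1) (by norm_num)).differentiable (by norm_num)) x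
  rw [iteratedFDeriv_two_apply, fderiv_clm_apply hd (differentiableAt_const _)]
  simp

theorem lap_add {N : ℕ} {f g : EuclideanSpace ℝ (Fin N) → ℝ} (hf : ContDiff ℝ 2 f)
    (hg : ContDiff ℝ 2 g) (x : EuclideanSpace ℝ (Fin N)) :
    lap N (fun y => f y + g y) x = lap N f x + lap N g x := by
  rw [lap_eq_laplacian hf, lap_eq_laplacian hg, lap_eq_laplacian (hf.add hg)]
  exact hf.contDiffAt.laplacian_add hg.contDiffAt

theorem lap_const_mul {N : ℕ} {f : EuclideanSpace ℝ (Fin N) → ℝ} (hf : ContDiff ℝ 2 f) (k : ℝ)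
    (x : EuclideanSpace ℝ (Fin N)) : lap N (fun y => k * f y) x = k * lap N f x := by
  rw [lap_eq_laplacian hf, lap_eq_laplacian (contDiff_const.mul hf)]
  exact InnerProductSpace.laplacian_smul k hf.contDiffAt

/-- The Laplacian is invariant under rigid motions. -/
theorem lap_comp_isometry_add {N : ℕ} {g : EuclideanSpace ℝ (Fin N) → ℝ} (hg : ContDiff ℝ 2 g)
    (R : EuclideanSpace ℝ (Fin N) ≃ₗᵢ[ℝ] EuclideanSpace ℝ (Fin N)) (p x : EuclideanSpace ℝ (Fin N)) :
    lap N (fun y => g (R y + p)) x = lap N g (R x + p) := by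
  have hg' : ContDiff ℝ 2 fun y => g (y + p) := hg.comp (contDiff_id.add contDiff_const)
  have hgR : ContDiff ℝ 2 fun y => g (R y + p) := hg'.comp R.contDiff
  rw [lap_eq_laplacian hg, lap_eq_laplacian hgR]
  have hb := EuclideanSpace.basisFun (Fin N) ℝ
  rw [InnerProductSpace.laplacian_eq_iteratedFDeriv_orthonormalBasis _ hb,
    InnerProductSpace.laplacian_eq_iteratedFDeriv_orthonormalBasis _ (hb.map R)]
  refine Finset.sum_congr rfl fun i _ => ?_
  rw [← iteratedFDeriv_comp_add_right 2 p (R x)]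
  have := (R : EuclideanSpace ℝ (Fin N) →L[ℝ] EuclideanSpace ℝ (Fin N)).iteratedFDeriv_comp_right
    hg' x (i := 2) le_rfl
  have h2 := congrArg (fun L => L ![hb i, hb i]) this
  simp only [ContinuousMultilinearMap.compContinuousLinearMap_apply] at h2
  refine Eq.trans h2 ?_
  simp only [OrthonormalBasis.map_apply]
  congr 1
  ext j
  fin_cases j <;> rfl

theorem iteratedFDeriv_two_nonneg_of_isLocalMin {E : Type*} [NormedAddCommGroup E]
    [NormedSpace ℝ E] {g : E → ℝ} (hg : ContDiff ℝ 2 g) {x : E} (h : IsLocalMin g x) (v : E) :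
    0 ≤ iteratedFDeriv ℝ 2 g x ![v, v] := by
  by_contra! hneg
  have hl (t : ℝ) : HasDerivAt (fun t : ℝ => x + t • v) v t := by
    simpa using ((hasDerivAt_id t).smul_const v).const_add x
  have h1 (t : ℝ) : HasDerivAt (fun t : ℝ => g (x + t • v)) (fderiv ℝ g (x + t • v) v) t :=
    ((hg.differentiable (by norm_num)) _).hasFDerivAt.comp_hasDerivAt t (hl t)
  have h2 : HasDerivAt (fun t : ℝ => fderiv ℝ g (x + t • v) v)
      (iteratedFDeriv ℝ 2 g x ![v, v]) 0 := by
    have hd : DifferentiableAt ℝ (fderiv ℝ g) (x + (0 : ℝ) • v) :=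
      ((hg.fderiv_right (m := 1) (by norm_num)).differentiable (by norm_num)) _
    have hc : HasDerivAt (fun t : ℝ => fderiv ℝ g (x + t • v))
        (fderiv ℝ (fderiv ℝ g) (x + (0 : ℝ) • v) v) 0 :=
      hd.hasFDerivAt.comp_hasDerivAt (0 : ℝ) (hl 0)
    have hc' := (ContinuousLinearMap.apply ℝ ℝ v).hasFDerivAt.comp_hasDerivAt (0 : ℝ) hc
    rw [iteratedFDeriv_two_apply]
    rw [zero_smul, add_zero] at hc'
    exact hc'
  have hd1 : deriv (fun t : ℝ => g (x + t • v)) = fun t => fderiv ℝ g (x + t • v) v :=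
    funext fun t => (h1 t).deriv
  have hmin : IsLocalMin (fun t : ℝ => g (x + t • v)) 0 := by
    have hc : Tendsto (fun t : ℝ => x + t • v) (nhds 0) (nhds x) := by
      simpa using (hl 0).continuousAt.tendsto
    simpa [IsLocalMin, IsMinFilter] using hc.eventually h
  have hmax : IsLocalMax (fun t : ℝ => g (x + t • v)) 0 := by
    refine isLocalMax_of_deriv_deriv_neg ?_ hmin.deriv_eq_zero (h1 0).continuousAt
    rw [hd1, h2.deriv]
    exact hneg
  have hconst : (fun t : ℝ => g (x + t • v)) =ᶠ[nhds 0] fun _ => g (x + (0 : ℝ) • v) := by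
    filter_upwards [hmin, hmax] with t ht ht'
    exact le_antisymm ht' ht
  have h0 : deriv (deriv fun t : ℝ => g (x + t • v)) 0 = 0 := by
    rw [hconst.deriv.deriv_eq]
    simp
  rw [hd1, h2.deriv] at h0
  exact hneg.ne h0

theorem lap_nonneg_of_isLocalMin {N : ℕ} {g : EuclideanSpace ℝ (Fin N) → ℝ} (hg : ContDiff ℝ 2 g)
    {x : EuclideanSpace ℝ (Fin N)} (h : IsLocalMin g x) : 0 ≤ lap N g x := by
  rw [lap_eq_laplacian hg, InnerProductSpace.laplacian_eq_iteratedFDeriv_orthonormalBasis g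
    (EuclideanSpace.basisFun (Fin N) ℝ)]
  exact Finset.sum_nonneg fun i _ => iteratedFDeriv_two_nonneg_of_isLocalMin hg h _

theorem fderiv_norm_sub_sq {E : Type*} [NormedAddCommGroup E] [InnerProductSpace ℝ E]
    (p x v : E) : fderiv ℝ (fun y => ‖y - p‖ ^ 2) x v = 2 * ⟪x - p, v⟫ := by
  have := ((hasFDerivAt_id x).sub_const p).norm_sq
  simpa [-map_sub, innerSL_apply_apply] using
    congrArg (fun L => L v) this.fderiv

theorem hasFDerivAt_inner_sub {E : Type*} [NormedAddCommGroup E] [InnerProductSpace ℝ E]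
    (q e x : E) : HasFDerivAt (fun y => ⟪y - q, e⟫) (innerSL ℝ e) x := by
  have h := (innerSL ℝ e).hasFDerivAt (x := x).sub_const ⟪e, q⟫
  refine h.congr_of_eventuallyEq (Eventually.of_forall fun y => ?_)
  simp [inner_sub_left, real_inner_comm]

theorem lap_norm_sub_sq {N : ℕ} (p x : EuclideanSpace ℝ (Fin N)) :
    lap N (fun y => ‖y - p‖ ^ 2) x = 2 * N := by
  have (v : EuclideanSpace ℝ (Fin N)) :
      fderiv ℝ (fun y => 2 * ⟪y - p, v⟫) x v = 2 * ‖v‖ ^ 2 := by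
    rw [((hasFDerivAt_inner_sub p v x).const_mul 2).fderiv]
    simp
  simp only [lap, fderiv_norm_sub_sq, this]
  simp [mul_comm]

theorem lap_quadratic_inner {N : ℕ} (q e x : EuclideanSpace ℝ (Fin N)) (he : ‖e‖ = 1) (α β : ℝ) :
    lap N (fun y => α * ⟪y - q, e⟫ + β * ⟪y - q, e⟫ ^ 2) x = 2 * β := by
  have h1 (x v : EuclideanSpace ℝ (Fin N)) :
      fderiv ℝ (fun y => α * ⟪y - q, e⟫ + β * ⟪y - q, e⟫ ^ 2) x v =
        (α + 2 * β * ⟪x - q, e⟫) * ⟪e, v⟫ := by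
    have h := hasFDerivAt_inner_sub q e x
    have h' := (h.const_mul α).add ((h.pow 2).const_mul β)
    rw [HasFDerivAt.fderiv (f := fun y => α * ⟪y - q, e⟫ + β * ⟪y - q, e⟫ ^ 2) h']
    simp
    ring
  have h2 (v : EuclideanSpace ℝ (Fin N)) :
      fderiv ℝ (fun y => (α + 2 * β * ⟪y - q, e⟫) * ⟪e, v⟫) x v = 2 * β * ⟪e, v⟫ ^ 2 := by
    rw [((((hasFDerivAt_inner_sub q e x).const_mul (2 * β)).const_add α).mul_const ⟪e, v⟫).fderiv]
    simp
    ring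
  simp only [lap, h1, h2, ← Finset.mul_sum]
  have := EuclideanSpace.real_norm_sq_eq e
  simp only [he, one_pow] at this
  simp [← this, EuclideanSpace.inner_single_right]

/-- `LapLE f c q` says that `Δ f ≤ c` near `q` in the following generalized sense: on a fixed ball
around `q` the function `f` is a uniform limit of `C²` functions whose Laplacian is at most `c`. -/
def LapLE {N : ℕ} (f : EuclideanSpace ℝ (Fin N) → ℝ) (c : ℝ) (q : EuclideanSpace ℝ (Fin N)) :
    Prop :=
  ∃ ρ > 0, ∀ δ > 0, ∃ g : EuclideanSpace ℝ (Fin N) → ℝ, ContDiff ℝ 2 g ∧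
    ∀ x ∈ ball q ρ, |g x - f x| ≤ δ ∧ lap N g x ≤ c

namespace LapLE

variable {N : ℕ} {f g : EuclideanSpace ℝ (Fin N) → ℝ} {c c' : ℝ} {q : EuclideanSpace ℝ (Fin N)}

theorem of_contDiff (hf : ContDiff ℝ 2 f) (h : ∀ x, lap N f x ≤ c) : LapLE f c q :=
  ⟨1, one_pos, fun δ hδ => ⟨f, hf, fun x _ => ⟨by simpa using hδ.le, h x⟩⟩⟩

theorem add (hf : LapLE f c q) (hg : LapLE g c' q) : LapLE (fun x => f x + g x) (c + c') q := by
  obtain ⟨ρ, hρ, H⟩ := hf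
  obtain ⟨ρ', hρ', H'⟩ := hg
  refine ⟨min ρ ρ', lt_min hρ hρ', fun δ hδ => ?_⟩
  obtain ⟨F, hF, h⟩ := H (δ / 2) (half_pos hδ)
  obtain ⟨G, hG, h'⟩ := H' (δ / 2) (half_pos hδ)
  refine ⟨fun x => F x + G x, hF.add hG, fun x hx => ⟨?_, ?_⟩⟩
  · have h1 := (h x (ball_subset_ball (min_le_left _ _) hx)).1
    have h2 := (h' x (ball_subset_ball (min_le_right _ _) hx)).1
    rw [abs_le] at *
    constructor <;> linarith
  · rw [lap_add hF hG]
    exact add_le_add (h x (ball_subset_ball (min_le_left _ _) hx)).2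
      (h' x (ball_subset_ball (min_le_right _ _) hx)).2

theorem const_mul (hf : LapLE f c q) {k : ℝ} (hk : 0 < k) : LapLE (fun x => k * f x) (k * c) q := by
  obtain ⟨ρ, hρ, H⟩ := hf
  refine ⟨ρ, hρ, fun δ hδ => ?_⟩
  obtain ⟨F, hF, h⟩ := H (δ / k) (div_pos hδ hk)
  refine ⟨fun x => k * F x, contDiff_const.mul hF, fun x hx => ⟨?_, ?_⟩⟩
  · rw [← mul_sub, abs_mul, abs_of_pos hk, mul_comm, ← le_div_iff₀ hk]
    exact (h x hx).1
  · rw [lap_const_mul hF]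
    exact mul_le_mul_of_nonneg_left (h x hx).2 hk.le

theorem comp_isometry_add
    (R : EuclideanSpace ℝ (Fin N) ≃ₗᵢ[ℝ] EuclideanSpace ℝ (Fin N)) (p : EuclideanSpace ℝ (Fin N))
    (hf : LapLE f c (R q + p)) : LapLE (fun x => f (R x + p)) c q := by
  obtain ⟨ρ, hρ, H⟩ := hf
  refine ⟨ρ, hρ, fun δ hδ => ?_⟩
  obtain ⟨F, hF, h⟩ := H δ hδ
  refine ⟨fun x => F (R x + p), hF.comp (R.contDiff.add contDiff_const), fun x hx => ?_⟩
  rw [lap_comp_isometry_add hF]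
  exact h _ (by simpa using hx)

theorem add_mul_norm_sub_sq (hf : LapLE f c q) (k : ℝ) (p : EuclideanSpace ℝ (Fin N)) :
    LapLE (fun x => f x + k * ‖x - p‖ ^ 2) (c + k * (2 * N)) q := by
  have hn : ContDiff ℝ 2 fun x : EuclideanSpace ℝ (Fin N) => ‖x - p‖ ^ 2 :=
    (contDiff_id.sub contDiff_const).norm_sq ℝ
  refine hf.add (of_contDiff (contDiff_const.mul hn) fun x => ?_)
  rw [lap_const_mul hn, lap_norm_sub_sq]

/-- A function whose generalized Laplacian is negative near `q` has no local minimum at `q`. -/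
theorem not_isLocalMin (hf : LapLE f c q) (hc : c < 0) : ¬ IsLocalMin f q := by
  intro hmin
  obtain ⟨ρ, hρ, H⟩ := hf
  obtain ⟨r₀, hr₀, hr₀f⟩ := Metric.eventually_nhds_iff_ball.1 hmin
  set r := min ρ r₀ / 2 with hr
  have hrpos : 0 < r := half_pos (lt_min hρ hr₀)
  have hrρ : r < ρ := (half_lt_self (lt_min hρ hr₀)).trans_le (min_le_left _ _)
  have hrr₀ : r < r₀ := (half_lt_self (lt_min hρ hr₀)).trans_le (min_le_right _ _)
  set k := -c / (4 * (N + 1)) with hk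
  have hN : (0 : ℝ) ≤ N := N.cast_nonneg
  have hkpos : 0 < k := div_pos (neg_pos.2 hc) (by positivity)
  have hkc : 4 * (N + 1) * k = -c := by rw [hk]; field_simp
  obtain ⟨g, hg, h⟩ := H (k * r ^ 2 / 4) (by positivity)
  have hn : ContDiff ℝ 2 fun x : EuclideanSpace ℝ (Fin N) => ‖x - q‖ ^ 2 :=
    (contDiff_id.sub contDiff_const).norm_sq ℝ
  have hG : ContDiff ℝ 2 fun x => g x + k * ‖x - q‖ ^ 2 := hg.add (contDiff_const.mul hn)
  obtain ⟨z, hz, hzmin⟩ := Metric.exists_isLocalMin_mem_ball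
    (f := fun x => g x + k * ‖x - q‖ ^ 2) (a := q) (z := q) (r := r) hG.continuous.continuousOn
    (mem_closedBall_self hrpos.le) fun x hx => by
      have hx' : dist x q = r := hx
      have h1 := (h q (mem_ball_self hρ)).1
      have h2 := (h x (by rw [mem_ball, hx']; exact hrρ)).1
      have h3 := hr₀f x (by rw [mem_ball, hx']; exact hrr₀)
      rw [dist_eq_norm] at hx'
      rw [abs_le] at h1 h2
      simp only [sub_self, norm_zero, hx']
      have : 0 < k * r ^ 2 := by positivity
      linarith
  have h1 := lap_nonneg_of_isLocalMin hG hzmin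
  rw [lap_add hg (contDiff_const.mul hn), lap_const_mul hn, lap_norm_sub_sq] at h1
  have h2 := (h z (ball_subset_ball hrρ.le hz)).2
  nlinarith

end LapLE

/-- Nondegeneracy: if `Δ u ≥ 1` wherever `u ≠ 0` in a ball and `u` is small compared with the square
of the radius, then `u` is nonpositive on the concentric ball of half the radius. -/
theorem nonpos_of_lapLE {N : ℕ} (hN : 0 < N) {u : EuclideanSpace ℝ (Fin N) → ℝ}
    (hu : Continuous u) {z : EuclideanSpace ℝ (Fin N)} {r : ℝ} (hr : 0 < r)
    (hlap : ∀ x ∈ closedBall z r, u x ≠ 0 → LapLE (fun y => -u y) (-1) x)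
    (hsmall : ∀ x ∈ closedBall z r, |u x| < r ^ 2 / (4 * N)) : u z ≤ 0 := by
  by_contra! hz
  have hN' : (0 : ℝ) < N := Nat.cast_pos.2 hN
  have hcont : Continuous fun x => -u x + 1 / (4 * N) * ‖x - z‖ ^ 2 := by fun_prop
  obtain ⟨q, hq, hqmin⟩ := (isCompact_closedBall z r).exists_isMinOn
    ⟨z, mem_closedBall_self hr.le⟩ hcont.continuousOn
  have hqz : -u q + 1 / (4 * N) * ‖q - z‖ ^ 2 ≤ -u z := by
    simpa only [sub_self, norm_zero, ne_eq, OfNat.ofNat_ne_zero, not_false_eq_true, zero_pow,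
      mul_zero, add_zero] using isMinOn_iff.1 hqmin z (mem_closedBall_self hr.le)
  rcases (mem_closedBall.1 hq).lt_or_eq with hlt | heq
  · have huq : u q ≠ 0 := by
      have : 0 ≤ 1 / (4 * (N : ℝ)) * ‖q - z‖ ^ 2 := by positivity
      intro h0
      linarith
    refine ((hlap q hq huq).add_mul_norm_sub_sq (1 / (4 * N)) z).not_isLocalMin ?_
      (hqmin.isLocalMin (closedBall_mem_nhds_of_mem hlt))
    field_simp
    norm_num
  · have := (abs_lt.1 (hsmall q hq)).2
    rw [dist_eq_norm] at heq
    rw [heq, one_div_mul_eq_div] at hqz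
    linarith

/-- A `C¹` function that satisfies `Δ u ≥ 1` wherever `u ≠ 0` in a ball and is small compared with
the square of the radius is nonnegative at the centre. -/
theorem nonneg_of_lapLE {N : ℕ} (hN : 0 < N) {u : EuclideanSpace ℝ (Fin N) → ℝ}
    (hu : ContDiff ℝ 1 u) {z : EuclideanSpace ℝ (Fin N)} {r : ℝ} (hr : 0 < r)
    (hlap : ∀ x ∈ closedBall z (2 * r), u x ≠ 0 → LapLE (fun y => -u y) (-1) x)
    (hsmall : ∀ x ∈ closedBall z (2 * r), |u x| < r ^ 2 / (4 * N)) : 0 ≤ u z := by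
  by_contra! hz
  have hN' : (0 : ℝ) < N := Nat.cast_pos.2 hN
  have hsub : closedBall z r ⊆ closedBall z (2 * r) := closedBall_subset_closedBall (by linarith)
  have hnonpos : ∀ p ∈ closedBall z r, u p ≤ 0 := by
    intro p hp
    have hp' : closedBall p r ⊆ closedBall z (2 * r) :=
      closedBall_subset_closedBall' (by rw [mem_closedBall] at hp; linarith)
    exact nonpos_of_lapLE hN hu.continuous hr (fun x hx => hlap x (hp' hx))
      fun x hx => hsmall x (hp' hx)
  have hu' := hu.continuous
  have hcont : Continuous fun x => -u x + 1 / (4 * N) * ‖x - z‖ ^ 2 := by fun_prop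
  obtain ⟨q, hq, hqmin⟩ := (isCompact_closedBall z r).exists_isMinOn
    ⟨z, mem_closedBall_self hr.le⟩ hcont.continuousOn
  have hqz : -u q + 1 / (4 * N) * ‖q - z‖ ^ 2 ≤ -u z := by
    simpa only [sub_self, norm_zero, ne_eq, OfNat.ofNat_ne_zero, not_false_eq_true, zero_pow,
      mul_zero, add_zero] using isMinOn_iff.1 hqmin z (mem_closedBall_self hr.le)
  have hzs := (abs_lt.1 (hsmall z (mem_closedBall_self (by linarith)))).1
  rcases (mem_closedBall.1 hq).lt_or_eq with hlt | heq
  · have hloc := hqmin.isLocalMin (closedBall_mem_nhds_of_mem hlt)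
    by_cases huq : u q = 0
    · have hmax : IsLocalMax u q := by
        filter_upwards [closedBall_mem_nhds_of_mem hlt] with x hx
        rw [huq]
        exact hnonpos x hx
      have hdu : DifferentiableAt ℝ u q := hu.differentiable (by norm_num) q
      have hdn : DifferentiableAt ℝ (fun x => ‖x - z‖ ^ 2) q :=
        (differentiableAt_id.sub_const z).norm_sq ℝ
      have h0 := congrArg (fun L => L (q - z)) hloc.fderiv_eq_zero
      rw [fderiv_fun_add hdu.fun_neg (hdn.const_mul _), fderiv_fun_neg, hmax.fderiv_eq_zero,
        fderiv_const_mul hdn] at h0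
      simp only [neg_zero, zero_add, smul_apply, fderiv_norm_sub_sq,
        zero_apply, real_inner_self_eq_norm_sq, smul_eq_mul] at h0
      have hqz0 : q - z = 0 := by simpa [hN.ne'] using h0
      rw [sub_eq_zero.1 hqz0] at huq
      linarith
    · refine ((hlap q (hsub hq) huq).add_mul_norm_sub_sq (1 / (4 * N)) z).not_isLocalMin ?_ hloc
      field_simp
      norm_num
  · have := hnonpos q hq
    rw [dist_eq_norm] at heq
    rw [heq, one_div_mul_eq_div] at hqz
    linarith

theorem setIntegral_eq_integral_of_tsupport_subset {N : ℕ} {η : EuclideanSpace ℝ (Fin N) → ℝ}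
    {ρ : ℝ} (hs : tsupport η ⊆ closedBall 0 ρ) {x : EuclideanSpace ℝ (Fin N)}
    {Ω : Set (EuclideanSpace ℝ (Fin N))} (hx : closedBall x ρ ⊆ Ω) :
    ∫ y in Ω, η (x - y) = ∫ y, η y := by
  rw [← integral_sub_left_eq_self η volume x]
  refine setIntegral_eq_integral_of_forall_compl_eq_zero fun y hy => ?_
  by_contra hne
  have := hs (subset_tsupport η (show x - y ∈ Function.support η from hne))
  rw [mem_closedBall, dist_zero_right, ← dist_eq_norm, dist_comm] at this
  exact hy (hx this)

section Mollification

open scoped Convolution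

variable {N : ℕ}

theorem fderiv_convolution_left_apply {η f : EuclideanSpace ℝ (Fin N) → ℝ}
    (hη : ContDiff ℝ 1 η) (hc : HasCompactSupport η) (hf : LocallyIntegrable f)
    (x v : EuclideanSpace ℝ (Fin N)) :
    fderiv ℝ (η ⋆[ContinuousLinearMap.lsmul ℝ ℝ] f) x v =
      ((fun a => fderiv ℝ η a v) ⋆[ContinuousLinearMap.lsmul ℝ ℝ] f) x := by
  rw [(hc.hasFDerivAt_convolution_left (ContinuousLinearMap.lsmul ℝ ℝ) hη hf x).fderiv]
  have := (hc.fderiv ℝ).convolutionExists_left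
    ((ContinuousLinearMap.lsmul ℝ ℝ : ℝ →L[ℝ] ℝ →L[ℝ] ℝ).precompL (EuclideanSpace ℝ (Fin N)))
    (hη.continuous_fderiv (by norm_num)) hf x
  simp_rw [convolution_def, ContinuousLinearMap.integral_apply this]
  rfl

theorem lap_convolution_left {η f : EuclideanSpace ℝ (Fin N) → ℝ} (hη : ContDiff ℝ 2 η)
    (hc : HasCompactSupport η) (hf : LocallyIntegrable f) (x : EuclideanSpace ℝ (Fin N)) :
    lap N (η ⋆[ContinuousLinearMap.lsmul ℝ ℝ] f) x = ∫ y, f y * lap N η (x - y) := by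
  have h1 (v : EuclideanSpace ℝ (Fin N)) : ContDiff ℝ 1 fun a => fderiv ℝ η a v :=
    (hη.fderiv_right (m := 1) (by norm_num)).clm_apply contDiff_const
  have hc1 (v : EuclideanSpace ℝ (Fin N)) : HasCompactSupport fun a => fderiv ℝ η a v :=
    hc.fderiv_apply ℝ v
  simp only [lap, fderiv_convolution_left_apply (hη.of_le (by norm_num)) hc hf]
  have h2 (v : EuclideanSpace ℝ (Fin N)) :
      fderiv ℝ (fun y => ((fun a => fderiv ℝ η a v) ⋆[ContinuousLinearMap.lsmul ℝ ℝ] f) y) x v =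
        ∫ t, fderiv ℝ (fun a => fderiv ℝ η a v) t v * f (x - t) :=
    fderiv_convolution_left_apply (h1 v) (hc1 v) hf x v
  simp only [h2]
  rw [← integral_finsetSum, ← integral_sub_left_eq_self _ volume x]
  · refine integral_congr_ae (Eventually.of_forall fun t => ?_)
    simp [Finset.mul_sum, mul_comm]
  · intro i _
    exact (((hc1 _).fderiv_apply ℝ _).convolutionExists_left (ContinuousLinearMap.lsmul ℝ ℝ)
      (((h1 _).continuous_fderiv (by norm_num)).clm_apply continuous_const) hf x)

theorem exists_mollifier {f : EuclideanSpace ℝ (Fin N) → ℝ} (hf : Continuous f)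
    (q : EuclideanSpace ℝ (Fin N)) {ρ δ : ℝ} (hρ : 0 < ρ) (hδ : 0 < δ) :
    ∃ η : EuclideanSpace ℝ (Fin N) → ℝ, ContDiff ℝ (⊤ : ℕ∞) η ∧ (∀ x, 0 ≤ η x) ∧ ∫ x, η x = 1 ∧
      tsupport η ⊆ closedBall 0 ρ ∧
      ∀ x ∈ ball q ρ, |(η ⋆[ContinuousLinearMap.lsmul ℝ ℝ] f) x - f x| ≤ δ := by
  have huc := (isCompact_closedBall q (2 * ρ)).uniformContinuousOn_of_continuous hf.continuousOn
  obtain ⟨d, hd, H⟩ := Metric.uniformContinuousOn_iff.1 huc δ hδ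
  have hr : 0 < min ρ d := lt_min hρ hd
  let φ : ContDiffBump (0 : EuclideanSpace ℝ (Fin N)) :=
    ⟨min ρ d / 2, min ρ d, half_pos hr, half_lt_self hr⟩
  refine ⟨φ.normed volume, φ.contDiff_normed, φ.nonneg_normed, φ.integral_normed, ?_, ?_⟩
  · rw [φ.tsupport_normed_eq]
    exact closedBall_subset_closedBall (min_le_left _ _)
  · intro x hx
    rw [← Real.dist_eq]
    refine φ.dist_normed_convolution_le hf.aestronglyMeasurable fun y hy => ?_
    have hy' : dist y x < min ρ d := hy
    rw [mem_ball] at hx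
    have hyq := dist_triangle y x q
    have := hy'.trans_le (min_le_left _ _)
    refine (H y ?_ x ?_ (hy'.trans_le (min_le_right _ _))).le
    · rw [mem_closedBall]; linarith
    · rw [mem_closedBall]; linarith

theorem hasCompactSupport_of_tsupport_subset_closedBall {η : EuclideanSpace ℝ (Fin N) → ℝ} {ρ : ℝ}
    (h : tsupport η ⊆ closedBall 0 ρ) : HasCompactSupport η :=
  (isCompact_closedBall 0 ρ).of_isClosed_subset (isClosed_tsupport η) h

theorem integral_fderiv_apply_eq_zero {η : EuclideanSpace ℝ (Fin N) → ℝ}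
    (hη : ContDiff ℝ 1 η) (hc : HasCompactSupport η) (v : EuclideanSpace ℝ (Fin N)) :
    ∫ x, fderiv ℝ η x v = 0 := by
  have h := integral_mul_fderiv_eq_neg_fderiv_mul_of_integrable (μ := volume)
    (f := fun _ : EuclideanSpace ℝ (Fin N) => (1 : ℝ)) (g := η) (v := v) (by simp)
    (by simpa using ((hη.continuous_fderiv (by norm_num)).clm_apply
      continuous_const).integrable_of_hasCompactSupport (hc.fderiv_apply ℝ v))
    (by simpa using hη.continuous.integrable_of_hasCompactSupport hc)
    (fun _ _ => differentiableAt_const _) (fun x _ => hη.differentiable (by norm_num) x)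
  simpa using h

theorem convolution_fderiv_apply {η u : EuclideanSpace ℝ (Fin N) → ℝ}
    (hη : ContDiff ℝ 1 η) (hc : HasCompactSupport η) (hu : ContDiff ℝ 1 u)
    (x v : EuclideanSpace ℝ (Fin N)) :
    (η ⋆[ContinuousLinearMap.lsmul ℝ ℝ] fun y => fderiv ℝ u y v) x =
      ((fun a => fderiv ℝ η a v) ⋆[ContinuousLinearMap.lsmul ℝ ℝ] u) x := by
  have hu1 : ContDiff ℝ 1 fun t => u (x - t) := hu.comp (contDiff_const.sub contDiff_id)
  have hd (t : EuclideanSpace ℝ (Fin N)) :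
      fderiv ℝ (fun t => u (x - t)) t v = -fderiv ℝ u (x - t) v := by
    have := (hu.differentiable (by norm_num) (x - t)).hasFDerivAt.comp t
      ((hasFDerivAt_id t).const_sub x)
    rw [HasFDerivAt.fderiv (f := fun t => u (x - t)) this]
    simp
  have hcη := (hη.continuous_fderiv (by norm_num)).clm_apply (continuous_const (y := v))
  have h := integral_mul_fderiv_eq_neg_fderiv_mul_of_integrable (μ := volume)
    (f := η) (g := fun t => u (x - t)) (v := v)
    ((hcη.mul hu1.continuous).integrable_of_hasCompactSupport (hc.fderiv_apply ℝ v).mul_right)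
    ((hη.continuous.mul ((hu1.continuous_fderiv (by norm_num)).clm_apply
      continuous_const)).integrable_of_hasCompactSupport hc.mul_right)
    ((hη.continuous.mul hu1.continuous).integrable_of_hasCompactSupport hc.mul_right)
    (fun x _ => hη.differentiable (by norm_num) x) (fun x _ => hu1.differentiable (by norm_num) x)
  simp only [hd, mul_neg, integral_neg, neg_inj] at h
  exact h

namespace MemP

variable {M : ℝ} {Ω : Set (EuclideanSpace ℝ (Fin N))} {u : EuclideanSpace ℝ (Fin N) → ℝ}
  {q : EuclideanSpace ℝ (Fin N)}

theorem lap_convolution (h : MemP N 1 0 M Ω u) {η : EuclideanSpace ℝ (Fin N) → ℝ}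
    (hη : ContDiff ℝ (⊤ : ℕ∞) η) {ρ : ℝ} (hs : tsupport η ⊆ closedBall 0 ρ)
    {x : EuclideanSpace ℝ (Fin N)} (hx : closedBall x ρ ⊆ ball 0 1) :
    lap N (η ⋆[ContinuousLinearMap.lsmul ℝ ℝ] u) x = ∫ y in Ω, η (x - y) := by
  obtain ⟨-, hu, hweak, -⟩ := h
  have hη2 : ContDiff ℝ 2 η := mod_cast contDiff_infty.1 hη 2
  rw [lap_convolution_left hη2 (hasCompactSupport_of_tsupport_subset_closedBall hs)
    hu.continuous.locallyIntegrable, ← hweak (fun y => η (x - y))]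
  · refine integral_congr_ae (Eventually.of_forall fun y => ?_)
    have := lap_comp_isometry_add hη2 (LinearIsometryEquiv.neg ℝ) x y
    simp only [LinearIsometryEquiv.coe_neg, neg_add_eq_sub] at this
    simp only [this]
  · exact hη.comp (contDiff_const.sub contDiff_id)
  · refine (closure_minimal (fun y hy => ?_) isClosed_closedBall).trans hx
    have := hs (subset_tsupport η (show x - y ∈ Function.support η from hy))
    rwa [mem_closedBall, dist_zero_right, ← dist_eq_norm, dist_comm] at this

theorem exists_closedBall_subset {U : Set (EuclideanSpace ℝ (Fin N))} (hU : IsOpen U)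
    (hq : q ∈ U) : ∃ ρ > 0, ∀ x ∈ ball q ρ, closedBall x ρ ⊆ U := by
  obtain ⟨r, hr, hrU⟩ := Metric.nhds_basis_closedBall.mem_iff.1 (hU.mem_nhds hq)
  refine ⟨r / 2, half_pos hr, fun x hx => (closedBall_subset_closedBall' ?_).trans hrU⟩
  rw [mem_ball] at hx
  linarith

theorem lapLE (h : MemP N 1 0 M Ω u) (hq : q ∈ ball 0 1) : LapLE u 1 q := by
  obtain ⟨ρ, hρ, hsub⟩ := exists_closedBall_subset isOpen_ball hq
  refine ⟨ρ, hρ, fun δ hδ => ?_⟩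
  obtain ⟨η, hη, hη0, hη1, hs, happ⟩ := exists_mollifier h.2.1.continuous q hρ hδ
  have hc := hasCompactSupport_of_tsupport_subset_closedBall hs
  refine ⟨_, hc.contDiff_convolution_left _ (n := 2) (hη.of_le (by exact_mod_cast le_top))
    h.2.1.continuous.locallyIntegrable, fun x hx => ⟨happ x hx, ?_⟩⟩
  rw [h.lap_convolution hη hs (hsub x hx), ← hη1, ← integral_sub_left_eq_self η volume x]
  exact setIntegral_le_integral
    ((hη.continuous.integrable_of_hasCompactSupport hc).comp_sub_left x)
    (Eventually.of_forall fun y => hη0 _)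

theorem lapLE_neg (h : MemP N 1 0 M Ω u) (hq : q ∈ ball 0 1) : LapLE (fun x => -u x) 0 q := by
  obtain ⟨ρ, hρ, hsub⟩ := exists_closedBall_subset isOpen_ball hq
  refine ⟨ρ, hρ, fun δ hδ => ?_⟩
  obtain ⟨η, hη, hη0, hη1, hs, happ⟩ := exists_mollifier h.2.1.continuous q hρ hδ
  have hc := hasCompactSupport_of_tsupport_subset_closedBall hs
  have hg := hc.contDiff_convolution_left (ContinuousLinearMap.lsmul ℝ ℝ) (μ := volume)
    (n := 2)
    (hη.of_le (by exact_mod_cast le_top)) h.2.1.continuous.locallyIntegrable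
  refine ⟨_, (contDiff_const (c := -1)).mul hg, fun x hx => ⟨?_, ?_⟩⟩
  · rw [← abs_neg]
    convert happ x hx using 2
    ring
  · rw [lap_const_mul hg, h.lap_convolution hη hs (hsub x hx), neg_one_mul, neg_nonpos]
    exact integral_nonneg fun y => hη0 _

theorem lapLE_neg_of_mem (h : MemP N 1 0 M Ω u) (hq : q ∈ ball 0 1) (hqΩ : q ∈ Ω) :
    LapLE (fun x => -u x) (-1) q := by
  obtain ⟨ρ, hρ, hsub⟩ := exists_closedBall_subset (isOpen_ball.inter h.1) ⟨hq, hqΩ⟩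
  refine ⟨ρ, hρ, fun δ hδ => ?_⟩
  obtain ⟨η, hη, hη0, hη1, hs, happ⟩ := exists_mollifier h.2.1.continuous q hρ hδ
  have hc := hasCompactSupport_of_tsupport_subset_closedBall hs
  have hg := hc.contDiff_convolution_left (ContinuousLinearMap.lsmul ℝ ℝ) (μ := volume)
    (n := 2)
    (hη.of_le (by exact_mod_cast le_top)) h.2.1.continuous.locallyIntegrable
  refine ⟨_, (contDiff_const (c := -1)).mul hg, fun x hx => ⟨?_, ?_⟩⟩
  · rw [← abs_neg]
    convert happ x hx using 2
    ring
  · rw [lap_const_mul hg, h.lap_convolution hη hs ((hsub x hx).trans inter_subset_left),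
      setIntegral_eq_integral_of_tsupport_subset hs ((hsub x hx).trans inter_subset_right),
      hη1, mul_one]

theorem lapLE_fderiv (h : MemP N 1 0 M Ω u) (hq : q ∈ ball 0 1) (hqΩ : q ∈ Ω)
    (e : EuclideanSpace ℝ (Fin N)) : LapLE (fun x => fderiv ℝ u x e) 0 q := by
  obtain ⟨ρ, hρ, hsub⟩ := exists_closedBall_subset (isOpen_ball.inter h.1) ⟨hq, hqΩ⟩
  refine ⟨ρ, hρ, fun δ hδ => ?_⟩
  have hcont : Continuous fun x => fderiv ℝ u x e :=
    (h.2.1.continuous_fderiv (by norm_num)).clm_apply continuous_const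
  obtain ⟨η, hη, hη0, hη1, hs, happ⟩ := exists_mollifier hcont q hρ hδ
  have hc := hasCompactSupport_of_tsupport_subset_closedBall hs
  have hη' : ContDiff ℝ 1 η := hη.of_le (by exact_mod_cast le_top)
  refine ⟨_, hc.contDiff_convolution_left _ (n := 2) (hη.of_le (by exact_mod_cast le_top))
    hcont.locallyIntegrable, fun x hx => ⟨happ x hx, ?_⟩⟩
  have hs' : tsupport (fun a => fderiv ℝ η a e) ⊆ closedBall 0 ρ :=
    (tsupport_fderiv_apply_subset ℝ e).trans hs
  rw [funext fun x => convolution_fderiv_apply hη' hc h.2.1 x e, h.lap_convolution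
    ((hη.fderiv_right (m := (⊤ : ℕ∞)) (by simp)).clm_apply contDiff_const) hs'
      ((hsub x hx).trans inter_subset_left),
    setIntegral_eq_integral_of_tsupport_subset hs' ((hsub x hx).trans inter_subset_right),
    integral_fderiv_apply_eq_zero hη' hc]

end MemP

end Mollification

theorem four_mul_max_mul_le {τ t : ℝ} (ht : 0 ≤ t) :
    4 * (max τ 0 * t) ≤ max (τ + t) 0 ^ 2 - max (τ - t) 0 ^ 2 := by
  rcases max_cases τ 0 with ⟨h1, h1'⟩ | ⟨h1, h1'⟩ <;>
  rcases max_cases (τ + t) 0 with ⟨h2, h2'⟩ | ⟨h2, h2'⟩ <;>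
  rcases max_cases (τ - t) 0 with ⟨h3, h3'⟩ | ⟨h3, h3'⟩ <;>
  rw [h1, h2, h3] <;> nlinarith

theorem reflection_add_sub {N : ℕ} {e : EuclideanSpace ℝ (Fin N)} (he : ‖e‖ = 1)
    (q x : EuclideanSpace ℝ (Fin N)) :
    (ℝ ∙ e)ᗮ.reflection x + (q - (ℝ ∙ e)ᗮ.reflection q) = x - (2 * ⟪x - q, e⟫) • e := by
  rw [add_sub_left_comm, ← map_sub, Submodule.reflection_orthogonal_apply,
    Submodule.reflection_singleton_apply, he, real_inner_comm]
  simp only [one_pow, RCLike.ofReal_real_eq_id, id_eq, div_one]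
  module

theorem HasDerivAt.nonneg_of_forall_Ioo {G : ℝ → ℝ} {G' ρ : ℝ} (h : HasDerivAt G G' 0)
    (hρ : 0 < ρ) (h0 : G 0 = 0) (hG : ∀ t ∈ Ioo 0 ρ, 0 ≤ G t) : 0 ≤ G' := by
  have ht : Tendsto (slope G 0) (nhdsWithin 0 (Ioi 0)) (nhds G') :=
    (hasDerivWithinAt_iff_tendsto_slope' (by simp)).1 h.hasDerivWithinAt
  refine ge_of_tendsto ht ?_
  filter_upwards [Ioo_mem_nhdsGT hρ] with t ht
  rw [slope_def_field, h0, sub_zero, sub_zero]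
  exact div_nonneg (hG t ht) ht.1.le

namespace MemP

variable {N : ℕ} {M : ℝ} {Ω : Set (EuclideanSpace ℝ (Fin N))}
  {u : EuclideanSpace ℝ (Fin N) → ℝ}

/-- The barrier estimate behind the lower bound for the directional derivative. -/
theorem barrier_nonneg (h : MemP N 1 0 M Ω u) {e : EuclideanSpace ℝ (Fin N)} (he : ‖e‖ = 1)
    {s k : ℝ} (hs : 0 < s) (hs1 : s ≤ 1) (hk : 0 < k) (hk4 : k < 1 / 4)
    (hclose : ∀ x ∈ ball (0 : EuclideanSpace ℝ (Fin N)) s,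
      |u x - (max ⟪x, e⟫ 0) ^ 2 / 2| < k ^ 2 * s ^ 2)
    {q : EuclideanSpace ℝ (Fin N)} (hq : q ∈ closedBall 0 (3 * s / 4))
    {x : EuclideanSpace ℝ (Fin N)} (hx : x ∈ closedBall q (k * s)) (hxe : 0 ≤ ⟪x - q, e⟫) :
    0 ≤ 1 / 2 * u x + 1 / 2 * -u (x - (2 * ⟪x - q, e⟫) • e) + 1 * ‖x - q‖ ^ 2 +
      (((N + 1) * (k * s) - max ⟪q, e⟫ 0) * ⟪x - q, e⟫ + -(N + 1) * ⟪x - q, e⟫ ^ 2) := by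
  set F : EuclideanSpace ℝ (Fin N) → ℝ := fun x =>
    1 / 2 * u x + 1 / 2 * -u (x - (2 * ⟪x - q, e⟫) • e) + 1 * ‖x - q‖ ^ 2 +
      (((N + 1) * (k * s) - max ⟪q, e⟫ 0) * ⟪x - q, e⟫ + -(N + 1) * ⟪x - q, e⟫ ^ 2) with hF
  change 0 ≤ F x
  by_contra! hneg
  have hu := h.2.1.continuous
  have hFc : Continuous F := by fun_prop
  have hball {y : EuclideanSpace ℝ (Fin N)} (hy : y ∈ closedBall q (k * s)) : y ∈ ball 0 s := by
    rw [mem_closedBall] at hy hq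
    rw [mem_ball]
    have := dist_triangle y q 0
    nlinarith
  have hrefl {y : EuclideanSpace ℝ (Fin N)} (hy : y ∈ closedBall q (k * s)) :
      y - (2 * ⟪y - q, e⟫) • e ∈ closedBall q (k * s) := by
    rw [← reflection_add_sub he, mem_closedBall, dist_eq_norm, add_sub_assoc, sub_sub_cancel_left,
      ← sub_eq_add_neg, ← map_sub, LinearIsometryEquiv.norm_map, ← dist_eq_norm]
    exact hy
  have hcompact : IsCompact (closedBall q (k * s) ∩ {y | 0 ≤ ⟪y - q, e⟫}) :=
    (isCompact_closedBall _ _).inter_right (isClosed_le continuous_const (by fun_prop))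
  obtain ⟨z, ⟨hz, hze⟩, hzmin⟩ := hcompact.exists_isMinOn ⟨x, hx, hxe⟩ hFc.continuousOn
  have hFz : F z < 0 := (isMinOn_iff.1 hzmin x ⟨hx, hxe⟩).trans_lt hneg
  have hze' : 0 ≤ ⟪z - q, e⟫ := hze
  have hN : (0 : ℝ) ≤ N := N.cast_nonneg
  rcases (mem_closedBall.1 hz).lt_or_eq with hlt | heq
  · rcases hze'.lt_or_eq with hpos | hzero
    · have hlap : LapLE F (1 / 2 * 1 + 1 / 2 * 0 + 1 * (2 * N) + 2 * -(N + 1)) z := by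
        have h1 := (h.lapLE (ball_subset_ball hs1 (hball hz))).const_mul (one_half_pos (α := ℝ))
        have h2 := (LapLE.comp_isometry_add (q := z) (ℝ ∙ e)ᗮ.reflection
          (q - (ℝ ∙ e)ᗮ.reflection q) (h.lapLE_neg (by
            rw [reflection_add_sub he]
            exact ball_subset_ball hs1 (hball (hrefl hz))))).const_mul (one_half_pos (α := ℝ))
        simp only [reflection_add_sub he] at h2
        have hi : ContDiff ℝ 2 fun y => ⟪y - q, e⟫ :=
          (contDiff_id.sub contDiff_const).inner ℝ contDiff_const
        exact ((h1.add h2).add_mul_norm_sub_sq 1 q).add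
          (LapLE.of_contDiff ((contDiff_const.mul hi).add (contDiff_const.mul (hi.pow 2)))
            fun y => (lap_quadratic_inner q e y he _ _).le)
      refine hlap.not_isLocalMin (by linarith) (hzmin.isLocalMin (inter_mem
        (closedBall_mem_nhds_of_mem hlt) ?_))
      have hopen : IsOpen {y : EuclideanSpace ℝ (Fin N) | 0 < ⟪y - q, e⟫} :=
        isOpen_lt continuous_const (by fun_prop)
      exact mem_of_superset (hopen.mem_nhds hpos) fun y hy =>
        (mem_ofPred.1 hy).le
    · have : F z = ‖z - q‖ ^ 2 := by
        simp only [hF, ← hzero, mul_zero, zero_smul, sub_zero]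
        ring
      have := sq_nonneg ‖z - q‖
      linarith
  · rw [dist_eq_norm] at heq
    have h1 := (abs_lt.1 (hclose z (hball hz))).1
    have h2 := (abs_lt.1 (hclose _ (hball (hrefl hz)))).2
    have hi1 : ⟪z, e⟫ = ⟪q, e⟫ + ⟪z - q, e⟫ := by rw [inner_sub_left]; ring
    have hi2 : ⟪z - (2 * ⟪z - q, e⟫) • e, e⟫ = ⟪q, e⟫ - ⟪z - q, e⟫ := by
      rw [inner_sub_left, real_inner_smul_left, real_inner_self_eq_norm_sq, he, hi1]
      ring
    rw [hi1] at h1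
    rw [hi2] at h2
    have h3 := four_mul_max_mul_le (τ := ⟪q, e⟫) hze'
    have h4 : ⟪z - q, e⟫ ≤ k * s := by
      have := real_inner_le_norm (z - q) e
      rwa [he, heq, mul_one] at this
    have h5 : 0 ≤ (N + 1) * (⟪z - q, e⟫ * (k * s - ⟪z - q, e⟫)) :=
      mul_nonneg (by linarith) (mul_nonneg hze' (sub_nonneg.2 h4))
    simp only [hF, heq] at hFz
    nlinarith

theorem le_fderiv (h : MemP N 1 0 M Ω u) {e : EuclideanSpace ℝ (Fin N)} (he : ‖e‖ = 1)
    {s k : ℝ} (hs : 0 < s) (hs1 : s ≤ 1) (hk : 0 < k) (hk4 : k < 1 / 4)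
    (hclose : ∀ x ∈ ball (0 : EuclideanSpace ℝ (Fin N)) s,
      |u x - (max ⟪x, e⟫ 0) ^ 2 / 2| < k ^ 2 * s ^ 2)
    {q : EuclideanSpace ℝ (Fin N)} (hq : q ∈ closedBall 0 (3 * s / 4)) :
    max ⟪q, e⟫ 0 - (N + 1) * (k * s) ≤ fderiv ℝ u q e := by
  set A : ℝ := (N + 1) * (k * s) - max ⟪q, e⟫ 0 with hA
  have hl (c : ℝ) : HasDerivAt (fun t : ℝ => u (q + (c * t) • e)) (fderiv ℝ u q (c • e)) 0 := by
    have h1 : HasDerivAt (fun t : ℝ => q + (c * t) • e) (c • e) 0 := by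
      simpa using (((hasDerivAt_id (0 : ℝ)).const_mul c).smul_const e).const_add q
    have h2 : HasFDerivAt u (fderiv ℝ u q) (q + (c * 0) • e) := by
      rw [mul_zero, zero_smul, add_zero]
      exact (h.2.1.differentiable (by norm_num) q).hasFDerivAt
    exact h2.comp_hasDerivAt (0 : ℝ) h1
  have hid := hasDerivAt_id (0 : ℝ)
  have hG : HasDerivAt (fun t : ℝ => 1 / 2 * u (q + (1 * t) • e) + 1 / 2 * -u (q + (-1 * t) • e) +
      t ^ 2 + (A * t + -(N + 1) * t ^ 2)) (fderiv ℝ u q e + A) 0 := by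
    have := ((((hl 1).const_mul (1 / 2)).fun_add ((hl (-1)).fun_neg.const_mul (1 / 2))).fun_add
      (hid.fun_pow 2)).fun_add ((hid.const_mul A).fun_add ((hid.fun_pow 2).const_mul (-(N + 1 : ℝ))))
    refine this.congr_deriv ?_
    simp
    ring
  have := hG.nonneg_of_forall_Ioo (mul_pos hk hs) (by simp) fun t ht => by
    have hsub : q + t • e - q = t • e := by abel
    have hin : ⟪t • e, e⟫ = t := by
      rw [real_inner_smul_left, real_inner_self_eq_norm_sq, he]
      ring
    have hno : ‖t • e‖ = t := by rw [norm_smul, he, mul_one, Real.norm_of_nonneg ht.1.le]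
    have hb := h.barrier_nonneg he hs hs1 hk hk4 hclose hq (x := q + t • e)
      (by rw [mem_closedBall, dist_eq_norm, hsub, hno]; exact ht.2.le)
      (by rw [hsub, hin]; exact ht.1.le)
    rw [hsub, hin, hno] at hb
    have he2 : q + t • e - (2 * t) • e = q + (-1 * t) • e := by module
    rw [he2] at hb
    rw [one_mul]
    linarith
  linarith

theorem mul_fderiv_sub_nonneg (hN : 0 < N) (h : MemP N 1 0 M Ω u) {e : EuclideanSpace ℝ (Fin N)}
    (he : ‖e‖ = 1) {s k : ℝ} (hs : 0 < s) (hs1 : s ≤ 1) (hk : 0 < k)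
    (hkN : 64 * N * (N + 2) * k < 1)
    (hclose : ∀ x ∈ ball (0 : EuclideanSpace ℝ (Fin N)) s,
      |u x - (max ⟪x, e⟫ 0) ^ 2 / 2| < k ^ 2 * s ^ 2)
    {y : EuclideanSpace ℝ (Fin N)} (hy : y ∈ ball 0 (s / 2)) :
    0 ≤ s * fderiv ℝ u y e - u y := by
  by_contra! hneg
  have hN1 : (1 : ℝ) ≤ N := Nat.one_le_cast.2 hN
  have hk4 : k < 1 / 4 := by
    have hN3 : (3 : ℝ) ≤ N * (N + 2) := by nlinarith
    nlinarith [mul_le_mul_of_nonneg_right hN3 hk.le]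
  have hcont : Continuous fun x => s * fderiv ℝ u x e + -u x + 1 / (4 * N) * ‖x - y‖ ^ 2 := by
    have h1 := h.2.1.continuous
    have h2 : Continuous fun x => fderiv ℝ u x e :=
      (h.2.1.continuous_fderiv (by norm_num)).clm_apply continuous_const
    fun_prop
  obtain ⟨q, hq, hqmin⟩ := (isCompact_closedBall y (s / 4)).exists_isMinOn
    ⟨y, mem_closedBall_self (by linarith)⟩ hcont.continuousOn
  have hqy : s * fderiv ℝ u q e + -u q + 1 / (4 * N) * ‖q - y‖ ^ 2 < 0 := by
    refine (isMinOn_iff.1 hqmin y (mem_closedBall_self (by linarith))).trans_lt ?_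
    simp only [sub_self, norm_zero, ne_eq, OfNat.ofNat_ne_zero, not_false_eq_true, zero_pow,
      mul_zero, add_zero]
    linarith
  have hq34 : q ∈ closedBall (0 : EuclideanSpace ℝ (Fin N)) (3 * s / 4) := by
    rw [mem_closedBall] at *
    rw [mem_ball] at hy
    have := dist_triangle q y 0
    linarith
  have hqs : q ∈ ball (0 : EuclideanSpace ℝ (Fin N)) s :=
    closedBall_subset_ball (by linarith) hq34
  rcases (mem_closedBall.1 hq).lt_or_eq with hlt | heq
  · have hqΩ : q ∈ Ω := by
      by_contra hqΩ
      obtain ⟨h0, hg⟩ := h.2.2.2.1 q ⟨ball_subset_ball hs1 hqs, hqΩ⟩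
      have hd : fderiv ℝ u q = 0 := by simpa [gradient] using hg
      have : 0 ≤ 1 / (4 * (N : ℝ)) * ‖q - y‖ ^ 2 := by positivity
      simp only [h0, hd, zero_apply] at hqy
      linarith
    refine ((((h.lapLE_fderiv (ball_subset_ball hs1 hqs) hqΩ e).const_mul hs).add
      (h.lapLE_neg_of_mem (ball_subset_ball hs1 hqs) hqΩ)).add_mul_norm_sub_sq
        (1 / (4 * N)) y).not_isLocalMin ?_ (hqmin.isLocalMin (closedBall_mem_nhds_of_mem hlt))
    field_simp
    norm_num
  · rw [dist_eq_norm] at heq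
    have h1 := h.le_fderiv he hs hs1 hk hk4 hclose hq34
    have h2 := (abs_lt.1 (hclose q hqs)).2
    have h3 : max ⟪q, e⟫ 0 ≤ s := by
      refine max_le ?_ hs.le
      have := real_inner_le_norm q e
      rw [he, mul_one] at this
      rw [mem_ball_zero_iff] at hqs
      linarith
    have h4 : 0 ≤ max ⟪q, e⟫ 0 := le_max_right _ _
    have h5 : 1 / (4 * (N : ℝ)) * ‖q - y‖ ^ 2 = 1 / (64 * N) * s ^ 2 := by
      rw [heq]
      field_simp
      norm_num
    rw [h5] at hqy
    have h6 : (N + 2) * k < 1 / (64 * N) := by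
      rw [lt_div_iff₀ (by positivity)]
      linarith
    have h7 : ((N + 2) * k) * s ^ 2 ≤ 1 / (64 * N) * s ^ 2 :=
      mul_le_mul_of_nonneg_right h6.le (by positivity)
    have h8 : k ^ 2 * s ^ 2 ≤ k * s ^ 2 := by
      have : k ^ 2 ≤ k := by nlinarith
      exact mul_le_mul_of_nonneg_right this (by positivity)
    have h9 := mul_le_mul_of_nonneg_left h1 hs.le
    nlinarith

theorem nonneg (hN : 0 < N) (h : MemP N 1 0 M Ω u) {e : EuclideanSpace ℝ (Fin N)}
    (he : ‖e‖ = 1) {s k : ℝ} (hs : 0 < s) (hs1 : s ≤ 1) (hk : 0 < k)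
    (hkN : 64 * N * (N + 2) * k < 1)
    (hclose : ∀ x ∈ ball (0 : EuclideanSpace ℝ (Fin N)) s,
      |u x - (max ⟪x, e⟫ 0) ^ 2 / 2| < k ^ 2 * s ^ 2)
    {x : EuclideanSpace ℝ (Fin N)} (hx : x ∈ ball 0 (s / 4)) : 0 ≤ u x := by
  by_contra! hneg
  have hN1 : (1 : ℝ) ≤ N := Nat.one_le_cast.2 hN
  have hk192 : 192 * k < 1 := by
    have hN3 : (3 : ℝ) ≤ N * (N + 2) := by nlinarith
    nlinarith [mul_le_mul_of_nonneg_right hN3 hk.le]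
  have hline (t : ℝ) (ht : t ∈ Icc 0 (s / 4)) : x - t • e ∈ ball 0 (s / 2) := by
    rw [mem_ball_zero_iff] at *
    have := norm_sub_le x (t • e)
    rw [norm_smul, he, mul_one, Real.norm_of_nonneg ht.1] at this
    linarith [ht.2]
  have hl (t : ℝ) : HasDerivAt (fun t : ℝ => x - t • e) (-e) t := by
    simpa using ((hasDerivAt_id t).smul_const e).const_sub x
  have hG (t : ℝ) : HasDerivAt (fun t => Real.exp (t / s) * u (x - t • e))
      (Real.exp (t / s) * (1 / s) * u (x - t • e) +
        Real.exp (t / s) * fderiv ℝ u (x - t • e) (-e)) t :=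
    ((hasDerivAt_id t).div_const s).exp.mul
      ((h.2.1.differentiable (by norm_num) _).hasFDerivAt.comp_hasDerivAt t (hl t))
  have hanti : AntitoneOn (fun t => Real.exp (t / s) * u (x - t • e)) (Icc 0 (s / 4)) := by
    refine antitoneOn_of_deriv_nonpos (convex_Icc _ _)
      (fun t _ => (hG t).continuousAt.continuousWithinAt)
      (fun t _ => (hG t).differentiableAt.differentiableWithinAt) fun t ht => ?_
    have hm := h.mul_fderiv_sub_nonneg hN he hs hs1 hk hkN hclose
      (hline t (interior_subset ht))
    rw [(hG t).deriv, map_neg]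
    have hpos := Real.exp_pos (t / s)
    have : Real.exp (t / s) * (1 / s) * u (x - t • e) +
        Real.exp (t / s) * -fderiv ℝ u (x - t • e) e =
        -(Real.exp (t / s) / s * (s * fderiv ℝ u (x - t • e) e - u (x - t • e))) := by
      field_simp
      ring
    rw [this, neg_nonpos]
    exact mul_nonneg (div_pos hpos hs).le hm
  set z := x - (s / 4) • e with hz
  have hs4 : (0 : ℝ) ≤ s / 4 := by linarith
  have huz : u z < 0 := by
    have h1 := hanti (left_mem_Icc.2 hs4) (right_mem_Icc.2 hs4) hs4
    simp only [zero_div, Real.exp_zero, one_mul, zero_smul, sub_zero] at h1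
    by_contra! h2
    have := mul_nonneg (Real.exp_pos (s / 4 / s)).le h2
    linarith
  have hze : ⟪z, e⟫ < -(s / 8) := by
    have hxs : x ∈ ball (0 : EuclideanSpace ℝ (Fin N)) s := ball_subset_ball (by linarith) hx
    have h1 := (abs_lt.1 (hclose x hxs)).1
    have h2 : ⟪z, e⟫ = ⟪x, e⟫ - s / 4 := by
      rw [hz, inner_sub_left, real_inner_smul_left, real_inner_self_eq_norm_sq, he]
      ring
    have h3 : max ⟪x, e⟫ 0 < 2 * (k * s) := by
      refine lt_of_pow_lt_pow_left₀ 2 (by positivity) ?_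
      nlinarith
    have h4 := le_max_left ⟪x, e⟫ 0
    nlinarith
  have hzs : z ∈ ball (0 : EuclideanSpace ℝ (Fin N)) (s / 2) := hline _ (right_mem_Icc.2 hs4)
  have hball : closedBall z (2 * (s / 16)) ⊆ ball 0 s := by
    intro y hy
    rw [mem_closedBall] at hy
    rw [mem_ball] at *
    have := dist_triangle y z 0
    linarith
  refine huz.not_ge (nonneg_of_lapLE hN h.2.1 (r := s / 16) (by positivity)
    (fun y hy hne => ?_) fun y hy => ?_)
  · have hy1 := ball_subset_ball hs1 (hball hy)
    refine h.lapLE_neg_of_mem hy1 ?_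
    by_contra hyΩ
    exact hne (h.2.2.2.1 y ⟨hy1, hyΩ⟩).1
  · have h1 := hclose y (hball hy)
    have h2 : ⟪y, e⟫ ≤ 0 := by
      have h3 : ⟪y - z, e⟫ ≤ 2 * (s / 16) := by
        have := real_inner_le_norm (y - z) e
        rw [mem_closedBall, dist_eq_norm] at hy
        rw [he, mul_one] at this
        linarith
      rw [inner_sub_left] at h3
      linarith
    rw [max_eq_right h2] at h1
    simp only [ne_eq, OfNat.ofNat_ne_zero, not_false_eq_true, zero_pow, zero_div, sub_zero] at h1
    refine h1.trans ?_
    have h4 : k ^ 2 * (1024 * N) < 1 := by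
      have : 192 * N * k ≤ 64 * N * (N + 2) * k := by
        nlinarith [mul_pos (by linarith : (0 : ℝ) < N) hk]
      nlinarith
    rw [lt_div_iff₀ (by positivity)]
    have : 0 < s ^ 2 := by positivity
    nlinarith

end MemP

/-- directional monotonicity and nonnegativity near a half-space solution. -/
theorem monotonicity_near_halfspace (N : ℕ) (hN : 2 ≤ N) (M : ℝ) (hM : 0 < M) :
    ∃ ε₁ : ℝ, 0 < ε₁ ∧
      ∀ ε s : ℝ, 0 < ε → ε < ε₁ → 0 < s → s ≤ 1 →
        ∀ (Ω : Set (EuclideanSpace ℝ (Fin N))) (u : EuclideanSpace ℝ (Fin N) → ℝ)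
          (e : EuclideanSpace ℝ (Fin N)),
          MemP N 1 0 M Ω u → ‖e‖ = 1 →
            (∀ x ∈ ball (0 : EuclideanSpace ℝ (Fin N)) s,
              |u x - (max ⟪x, e⟫ 0) ^ 2 / 2| < ε * s ^ 2) →
            (∀ x ∈ ball (0 : EuclideanSpace ℝ (Fin N)) (s / 2),
              0 ≤ s * fderiv ℝ u x e - u x) ∧
            ∀ x ∈ ball (0 : EuclideanSpace ℝ (Fin N)) (s / 4), 0 ≤ u x := by
  have hN0 : 0 < N := by omega
  have hNpos : (0 : ℝ) < N := Nat.cast_pos.2 hN0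
  refine ⟨(1 / (64 * N * (N + 2))) ^ 2, by positivity,
    fun ε s hε hε₁ hs hs1 Ω u e h he hclose => ?_⟩
  have hk : 0 < √ε := Real.sqrt_pos.2 hε
  have hkN : 64 * N * (N + 2) * √ε < 1 := by
    have : √ε < 1 / (64 * N * (N + 2)) := (Real.sqrt_lt' (by positivity)).2 hε₁
    rwa [lt_div_iff₀ (by positivity), mul_comm] at this
  rw [← Real.sq_sqrt hε.le] at hclose
  exact ⟨fun x hx => h.mul_fderiv_sub_nonneg hN0 he hs hs1 hk hkN hclose hx,
    fun x hx => h.nonneg hN0 he hs hs1 hk hkN hclose hx⟩
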